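/- (Proposition 2, case (i).) Let g : (−∞, 0) → ℝ and suppose that for every μ ∈ (0,∞) there is a probability mass function f_μ on ℕ with Σ_n f_μ(n) t^n = g(μ(t−1)) for all t ∈ [0,1). Then every f_μ is a mixed Poisson distribution: for each μ there exists a probability measure ν on [0,∞) such that f_μ(n) = ∫_{[0,∞)} e^{−λ} λ^n / n! dν(λ) for all n ∈ ℕ. -/

import Mathlib

open scoped BigOperators
open MeasureTheory

/-- `f` is a probability mass function on `ℕ`. -/
def IsPMF (f : ℕ → ℝ) : Prop := (∀ n, 0 ≤ f n) ∧ HasSum f 1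

open Filter Topology

/-- Continuity of an absolutely summable power series on `[0,1]`. -/
lemma continuousOn_powerSum (c : ℕ → ℝ) (hc : Summable fun n => |c n|) :
    ContinuousOn (fun t : ℝ => ∑' n, c n * t ^ n) (Set.Icc 0 1) := by
  refine continuousOn_tsum (fun n => by fun_prop) hc ?_
  intro n x hx
  rw [Real.norm_eq_abs, abs_mul, abs_of_nonneg (pow_nonneg hx.1 n)]
  exact mul_le_of_le_one_right (abs_nonneg _) (pow_le_one₀ hx.1 hx.2)

/-- Uniqueness of coefficients. -/
lemma coeff_zero_of_powerSum (c : ℕ → ℝ) (hc : Summable fun n => |c n|)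
    (h : ∀ t ∈ Set.Ioo (0 : ℝ) 1, ∑' n, c n * t ^ n = 0) : ∀ n, c n = 0 := by
  intro n
  induction n using Nat.strong_induction_on with
  | _ n ih =>
    have hc' : Summable fun m => |c (m + n)| := (summable_nat_add_iff n).2 hc
    have hz : ∀ t ∈ Set.Ioo (0 : ℝ) 1, ∑' m, c (m + n) * t ^ m = 0 := by
      intro t ht
      have hs : Summable fun m => c m * t ^ m := by
        refine Summable.of_norm_bounded hc fun m => ?_
        rw [Real.norm_eq_abs, abs_mul, abs_of_nonneg (pow_nonneg ht.1.le m)]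
        exact mul_le_of_le_one_right (abs_nonneg _) (pow_le_one₀ ht.1.le ht.2.le)
      have h1 := hs.sum_add_tsum_nat_add n
      rw [h t ht, Finset.sum_eq_zero (fun i hi => by
        rw [ih i (Finset.mem_range.1 hi), zero_mul]), zero_add] at h1
      have h2 : ∑' m, c (m + n) * t ^ (m + n) = t ^ n * ∑' m, c (m + n) * t ^ m := by
        rw [← tsum_mul_left]
        exact tsum_congr fun m => by ring
      rw [h2] at h1
      exact (mul_eq_zero.1 h1).resolve_left (pow_ne_zero _ ht.1.ne')
    have hcont := (continuousOn_powerSum _ hc') 0 (by simp)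
    have hcont2 := hcont.mono Set.Ioo_subset_Icc_self
    have hev : Tendsto (fun t : ℝ => ∑' m, c (m + n) * t ^ m) (𝓝[Set.Ioo 0 1] 0) (𝓝 0) := by
      refine tendsto_const_nhds.congr' ?_
      filter_upwards [self_mem_nhdsWithin] with t ht using (hz t ht).symm
    have : (𝓝[Set.Ioo (0 : ℝ) 1] 0).NeBot := by
      rw [nhdsWithin_Ioo_eq_nhdsGT one_pos]; infer_instance
    have := tendsto_nhds_unique hcont2 hev
    beta_reduce at this
    rw [tsum_eq_single 0 (fun m hm => by simp [hm])] at this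
    simpa using this

/-- The law of `exp (-a X)`, `X ~ f`, as a probability measure on `[0,1]`. -/
lemma exists_law (f : ℕ → ℝ) (hf : IsPMF f) (a : ℝ) (ha : 0 < a) :
    ∃ P : ProbabilityMeasure (Set.Icc (0 : ℝ) 1), ∀ s : ℝ, 0 < s →
      ∫ y, (y : ℝ) ^ s ∂(P : Measure (Set.Icc (0 : ℝ) 1)) =
        ∑' m, f m * Real.exp (-(s * a)) ^ m := by
  let p : PMF ℕ := ⟨fun n => ENNReal.ofReal (f n), by
    have h := ENNReal.ofReal_tsum_of_nonneg hf.1 hf.2.summable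
    rw [hf.2.tsum_eq, ENNReal.ofReal_one] at h
    rw [h]
    exact ENNReal.summable.hasSum⟩
  have hp : ∀ n, p n = ENNReal.ofReal (f n) := fun n => rfl
  let F : ℕ → Set.Icc (0 : ℝ) 1 := fun m => ⟨Real.exp (-(m * a)), (Real.exp_pos _).le,
    Real.exp_le_one_iff.2 (by have : (0 : ℝ) ≤ m * a := by positivity
                              linarith)⟩
  have hF : Measurable F := measurable_of_countable F
  refine ⟨⟨p.toMeasure.map F, Measure.isProbabilityMeasure_map hF.aemeasurable⟩, ?_⟩
  intro s hs
  have hcont : Continuous fun y : Set.Icc (0 : ℝ) 1 => (y : ℝ) ^ s :=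
    continuous_subtype_val.rpow_const fun _ => Or.inr hs.le
  rw [ProbabilityMeasure.coe_mk, integral_map hF.aemeasurable hcont.aestronglyMeasurable,
    PMF.integral_eq_tsum]
  · refine tsum_congr fun m => ?_
    rw [hp, ENNReal.toReal_ofReal (hf.1 m), smul_eq_mul]
    congr 1
    change Real.exp (-(m * a)) ^ s = _
    rw [← Real.exp_mul, ← Real.exp_nat_mul]
    congr 1; ring
  · refine Integrable.of_bound (C := 1) (measurable_of_countable _).aestronglyMeasurable ?_
    refine Eventually.of_forall fun m => ?_
    rw [Real.norm_eq_abs, abs_of_nonneg (Real.rpow_nonneg (F m).2.1 _)]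
    exact Real.rpow_le_one (F m).2.1 (F m).2.2 hs.le

lemma tendsto_scale (s : ℝ) :
    Tendsto (fun k : ℕ => ((k : ℝ) + 1) * (1 - Real.exp (-(s * ((k : ℝ) + 1)⁻¹)))) atTop (𝓝 s) := by
  have hd : HasDerivAt (fun x : ℝ => -Real.exp (-(s * x))) s 0 := by
    have := (((hasDerivAt_id (0 : ℝ)).const_mul s).fun_neg.exp).fun_neg
    simpa using this
  have h := hd.tendsto_slope_zero_right
  have hk : Tendsto (fun k : ℕ => ((k : ℝ) + 1)⁻¹) atTop (𝓝[>] 0) :=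
    tendsto_inv_atTop_nhdsGT_zero.comp
      (tendsto_atTop_add_const_right _ _ tendsto_natCast_atTop_atTop)
  refine (h.comp hk).congr fun k => ?_
  simp only [Function.comp, smul_eq_mul, inv_inv, zero_add, mul_zero, neg_zero, Real.exp_zero]
  ring

/-- The limiting measure on `[0,1]`. -/
lemma exists_limit (g : ℝ → ℝ) (f : ℝ → ℕ → ℝ)
    (hpmf : ∀ μ : ℝ, 0 < μ → IsPMF (f μ))
    (hpgf : ∀ μ : ℝ, 0 < μ → ∀ t ∈ Set.Ico (0 : ℝ) 1,
      ∑' n : ℕ, f μ n * t ^ n = g (μ * (t - 1)))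
    (μ : ℝ) (hμ : 0 < μ) :
    ∃ P : ProbabilityMeasure (Set.Icc (0 : ℝ) 1), ∀ s ∈ Set.Ioo (0 : ℝ) 1,
      ∫ y, (y : ℝ) ^ s ∂(P : Measure (Set.Icc (0 : ℝ) 1)) = ∑' n, f μ n * (1 - s) ^ n := by
  have hkpos : ∀ k : ℕ, (0 : ℝ) < (k : ℝ) + 1 := fun k => by positivity
  choose P hP using fun k : ℕ => exists_law (f (((k : ℝ) + 1) * μ))
    (hpmf _ (mul_pos (hkpos k) hμ)) (((k : ℝ) + 1)⁻¹) (inv_pos.2 (hkpos k))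
  let U : Ultrafilter ℕ := hyperfilter ℕ
  obtain ⟨Q, hQ⟩ : ∃ Q, Tendsto P (U : Filter ℕ) (𝓝 Q) :=
    ⟨(U.map P).lim, (U.map P).le_nhds_lim⟩
  have hU : (U : Filter ℕ) ≤ atTop := by
    rw [← Nat.cofinite_eq_atTop]; exact hyperfilter_le_cofinite
  refine ⟨Q, fun s hs => ?_⟩
  have hcont : Continuous fun y : Set.Icc (0 : ℝ) 1 => (y : ℝ) ^ s :=
    continuous_subtype_val.rpow_const fun _ => Or.inr hs.1.le
  have h1 := (ProbabilityMeasure.tendsto_iff_forall_integral_tendsto.1 hQ)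
    (BoundedContinuousFunction.mkOfCompact ⟨_, hcont⟩)
  simp only [BoundedContinuousFunction.mkOfCompact_apply, ContinuousMap.coe_mk] at h1
  refine tendsto_nhds_unique h1 ?_
  have hsum : Summable fun n => |f μ n| := by
    simpa only [abs_of_nonneg ((hpmf μ hμ).1 _)] using (hpmf μ hμ).2.summable
  have hc := continuousOn_powerSum (f μ) hsum
  have hca : ContinuousAt (fun t : ℝ => ∑' n, f μ n * t ^ n) (1 - s) :=
    hc.continuousAt (Icc_mem_nhds (by linarith [hs.2]) (by linarith [hs.1]))
  have h2 := hca.tendsto.comp (((tendsto_scale s).mono_left hU).const_sub 1)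
  refine h2.congr fun k => ?_
  have hK := hkpos k
  set K : ℝ := (k : ℝ) + 1 with hKdef
  have hpos : 0 < s * K⁻¹ := mul_pos hs.1 (inv_pos.2 hK)
  have hlt : Real.exp (-(s * K⁻¹)) < 1 := by
    rw [Real.exp_lt_one_iff]; linarith
  have hge : 1 - s * K⁻¹ ≤ Real.exp (-(s * K⁻¹)) := by
    linarith [Real.add_one_le_exp (-(s * K⁻¹))]
  have hle : K * (1 - Real.exp (-(s * K⁻¹))) ≤ s := by
    calc K * (1 - Real.exp (-(s * K⁻¹))) ≤ K * (s * K⁻¹) := by gcongr; linarith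
      _ = s := by field_simp
  have hp2 : 0 < K * (1 - Real.exp (-(s * K⁻¹))) := mul_pos hK (by linarith)
  rw [hP k s hs.1, hpgf _ (mul_pos hK hμ) _ ⟨(Real.exp_pos _).le, hlt⟩]
  simp only [Function.comp]
  rw [hpgf μ hμ _ ⟨by linarith [hs.2], by linarith⟩]
  congr 1
  ring

/-- Proposition 2, case (i): if for every `μ ∈ (0,∞)` there is a pmf `f_μ`
on `ℕ` whose pgf is `g(μ(t-1))` for `t ∈ [0,1)`, then every `f_μ` is mixed Poisson: there
is a probability measure `ν` on `[0,∞)` with `f_μ(n) = ∫ e^{-λ} λ^n / n! dν(λ)`. -/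
theorem mixedPoisson_of_pgf_form_all_means (g : ℝ → ℝ) (f : ℝ → ℕ → ℝ)
    (hpmf : ∀ μ : ℝ, 0 < μ → IsPMF (f μ))
    (hpgf : ∀ μ : ℝ, 0 < μ → ∀ t ∈ Set.Ico (0 : ℝ) 1,
      ∑' n : ℕ, f μ n * t ^ n = g (μ * (t - 1)))
    (μ : ℝ) (hμ : 0 < μ) :
    ∃ ν : Measure ℝ, IsProbabilityMeasure ν ∧ ν (Set.Iio 0) = 0 ∧
      ∀ n : ℕ, f μ n = ∫ x, Real.exp (-x) * x ^ n / n.factorial ∂ν := by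
  obtain ⟨P, hP⟩ := exists_limit g f hpmf hpgf μ hμ
  have hsum : Summable fun n => |f μ n| := by
    simpa only [abs_of_nonneg ((hpmf μ hμ).1 _)] using (hpmf μ hμ).2.summable
  have hc := continuousOn_powerSum (f μ) hsum
  set ρ : Measure (Set.Icc (0 : ℝ) 1) := (P : Measure (Set.Icc (0 : ℝ) 1)) with hρ
  -- no mass at zero
  have hk : Tendsto (fun k : ℕ => ((k : ℝ) + 2)⁻¹) atTop (𝓝 0) :=
    tendsto_inv_atTop_zero.comp
      (tendsto_atTop_add_const_right _ _ tendsto_natCast_atTop_atTop)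
  have hkI : ∀ k : ℕ, ((k : ℝ) + 2)⁻¹ ∈ Set.Ioo (0 : ℝ) 1 := fun k =>
    ⟨by positivity, inv_lt_one_of_one_lt₀ (by have : (0 : ℝ) ≤ k := k.cast_nonneg
                                              linarith)⟩
  have hzero : ∀ᵐ y : Set.Icc (0 : ℝ) 1 ∂ρ, (y : ℝ) ≠ 0 := by
    have hS : MeasurableSet {y : Set.Icc (0 : ℝ) 1 | (y : ℝ) ≠ 0} :=
      (measurable_subtype_coe (measurableSet_singleton (0 : ℝ))).compl
    have h1 : Tendsto (fun k : ℕ => ∫ y, (y : ℝ) ^ (((k : ℝ) + 2)⁻¹) ∂ρ) atTop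
        (𝓝 (∫ y, Set.indicator {y : Set.Icc (0 : ℝ) 1 | (y : ℝ) ≠ 0} (fun _ => (1 : ℝ)) y ∂ρ)) := by
      refine tendsto_integral_of_dominated_convergence (fun _ => 1) ?_ (integrable_const _) ?_ ?_
      · intro k
        exact (continuous_subtype_val.rpow_const
          fun _ => Or.inr (hkI k).1.le).aestronglyMeasurable
      · intro k
        refine Eventually.of_forall fun y => ?_
        rw [Real.norm_eq_abs, abs_of_nonneg (Real.rpow_nonneg y.2.1 _)]
        exact Real.rpow_le_one y.2.1 y.2.2 (hkI k).1.le
      · refine Eventually.of_forall fun y => ?_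
        by_cases hy : (y : ℝ) = 0
        · have : ∀ k : ℕ, (y : ℝ) ^ (((k : ℝ) + 2)⁻¹) = 0 := fun k => by
            rw [hy, Real.zero_rpow (hkI k).1.ne']
          simp only [this]
          rw [Set.indicator_of_notMem (by simpa using hy)]
          exact tendsto_const_nhds
        · rw [Set.indicator_of_mem (by simpa using hy)]
          have := (Real.continuousAt_const_rpow (b := 0) hy).tendsto.comp hk
          simpa [Function.comp_def] using this
    have h2 : Tendsto (fun k : ℕ => ∫ y, (y : ℝ) ^ (((k : ℝ) + 2)⁻¹) ∂ρ) atTop (𝓝 1) := by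
      have h3 : Tendsto (fun k : ℕ => 1 - ((k : ℝ) + 2)⁻¹) atTop (𝓝[Set.Icc 0 1] 1) := by
        refine tendsto_nhdsWithin_iff.2 ⟨by simpa using hk.const_sub 1, ?_⟩
        exact Eventually.of_forall fun k => ⟨by linarith [(hkI k).2], by linarith [(hkI k).1]⟩
      have h4 := (hc 1 (by simp)).tendsto.comp h3
      simp only [one_pow, mul_one, (hpmf μ hμ).2.tsum_eq] at h4
      exact h4.congr fun k => (hP _ (hkI k)).symm
    have h5 := tendsto_nhds_unique h1 h2
    rw [integral_indicator_const _ hS, smul_eq_mul, mul_one] at h5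
    rw [ae_iff]
    have h6 : ρ {y : Set.Icc (0 : ℝ) 1 | (y : ℝ) ≠ 0} = 1 := by
      rw [measureReal_def] at h5
      rw [← ENNReal.ofReal_toReal (measure_ne_top ρ _), h5, ENNReal.ofReal_one]
    have := (prob_compl_eq_zero_iff hS).2 h6
    exact this
  -- the mixing measure
  let L : Set.Icc (0 : ℝ) 1 → ℝ := fun y => -Real.log y
  have hL : Measurable L := (Real.measurable_log.comp measurable_subtype_coe).neg
  have hν : IsProbabilityMeasure (ρ.map L) := Measure.isProbabilityMeasure_map hL.aemeasurable
  have hLnn : ∀ y, 0 ≤ L y := fun y => by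
    have := Real.log_nonpos y.2.1 y.2.2
    simp only [L]; linarith
  have hneg : (ρ.map L) (Set.Iio 0) = 0 := by
    rw [Measure.map_apply hL measurableSet_Iio]
    have : L ⁻¹' Set.Iio 0 = ∅ := by
      ext y; simpa using hLnn y
    rw [this, measure_empty]
  have hae : ∀ᵐ x ∂(ρ.map L), 0 ≤ x := by
    rw [ae_iff]; simpa [Set.Iio] using hneg
  refine ⟨ρ.map L, hν, hneg, ?_⟩
  set ν := ρ.map L with hνdef
  have hHS : ∀ t x : ℝ, HasSum (fun n : ℕ => Real.exp (-x) * x ^ n / n.factorial * t ^ n)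
      (Real.exp (-x) * Real.exp (x * t)) := by
    intro t x
    have h := (NormedSpace.expSeries_div_hasSum_exp (x * t)).mul_left (Real.exp (-x))
    rw [← Real.exp_eq_exp_ℝ] at h
    refine h.congr_fun ?_ 
    intro n; rw [mul_pow]; ring
  have hone : ∀ x : ℝ, HasSum (fun n : ℕ => Real.exp (-x) * x ^ n / n.factorial) 1 := by
    intro x
    have := hHS 1 x
    simpa [← Real.exp_add] using this
  have hsumI : ∀ t ∈ Set.Icc (0 : ℝ) 1,
      HasSum (fun n : ℕ => (∫ x, Real.exp (-x) * x ^ n / n.factorial ∂ν) * t ^ n)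
        (∫ x, Real.exp (-x) * Real.exp (x * t) ∂ν) := by
    intro t ht
    have := hasSum_integral_of_dominated_convergence (μ := ν)
      (F := fun (n : ℕ) x => Real.exp (-x) * x ^ n / n.factorial * t ^ n)
      (f := fun x => Real.exp (-x) * Real.exp (x * t))
      (fun n x => Real.exp (-x) * x ^ n / n.factorial)
      (fun n => by
        refine Continuous.aestronglyMeasurable ?_
        fun_prop)
      (fun n => by
        filter_upwards [hae] with x hx
        have h0 : 0 ≤ Real.exp (-x) * x ^ n / n.factorial := by positivity
        rw [Real.norm_eq_abs, abs_of_nonneg (mul_nonneg h0 (pow_nonneg ht.1 n))]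
        exact mul_le_of_le_one_right h0 (pow_le_one₀ ht.1 ht.2))
      (Eventually.of_forall fun x => (hone x).summable)
      (by simp only [(hone _).tsum_eq]; exact integrable_const _)
      (Eventually.of_forall fun x => hHS t x)
    simpa only [integral_mul_const] using this
  have hann : ∀ n : ℕ, 0 ≤ ∫ x, Real.exp (-x) * x ^ n / n.factorial ∂ν := fun n =>
    integral_nonneg_of_ae (by
      filter_upwards [hae] with x hx
      simp only [Pi.zero_apply]; positivity)
  have hasum : Summable fun n : ℕ => |∫ x, Real.exp (-x) * x ^ n / n.factorial ∂ν| := by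
    have := (hsumI 1 (by simp)).summable
    simpa only [abs_of_nonneg (hann _), one_pow, mul_one] using this
  have key := coeff_zero_of_powerSum
    (fun n => f μ n - ∫ x, Real.exp (-x) * x ^ n / n.factorial ∂ν)
    (Summable.of_nonneg_of_le (fun _ => abs_nonneg _) (fun n => abs_sub _ _) (hsum.add hasum))
    (by
      intro t ht
      have hs : Summable fun m => f μ m * t ^ m := by
        refine Summable.of_norm_bounded hsum fun m => ?_
        rw [Real.norm_eq_abs, abs_mul, abs_of_nonneg (pow_nonneg ht.1.le m)]
        exact mul_le_of_le_one_right (abs_nonneg _) (pow_le_one₀ ht.1.le ht.2.le)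
      have hI := hsumI t ⟨ht.1.le, ht.2.le⟩
      simp only [sub_mul]
      rw [hs.tsum_sub hI.summable, hI.tsum_eq, sub_eq_zero]
      have h1 := hP (1 - t) ⟨by linarith [ht.2], by linarith [ht.1]⟩
      rw [sub_sub_cancel] at h1
      rw [← h1, hνdef, integral_map hL.aemeasurable
        (Continuous.aestronglyMeasurable (by fun_prop))]
      refine integral_congr_ae ?_
      filter_upwards [hzero] with y hy
      have hy0 : 0 < (y : ℝ) := lt_of_le_of_ne y.2.1 (Ne.symm hy)
      rw [Real.rpow_def_of_pos hy0, ← Real.exp_add]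
      simp only [L]
      congr 1; ring)
  intro n
  exact sub_eq_zero.1 (key n)
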